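/- For all r, s ∈ {1,…,m} and every holomorphic function f on an open set U ⊆ ℂ^m, the Gaudin Hamiltonians commute: (H_r(H_s f))(x) = (H_s(H_r f))(x) for all x ∈ U. -/

import Mathlib

/-- Complex partial derivative `∂f/∂x_r` (this is `D_r⁺ f`). -/
noncomputable def pd {m : ℕ} (r : Fin m) (f : (Fin m → ℂ) → ℂ) : (Fin m → ℂ) → ℂ :=
  fun x => fderiv ℂ f x (Pi.single r 1)

/-- `D_r⁰ f = x_r ∂f/∂x_r - j_r f`. -/
noncomputable def D0 {m : ℕ} (j : Fin m → ℂ) (r : Fin m) (f : (Fin m → ℂ) → ℂ) :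
    (Fin m → ℂ) → ℂ :=
  fun x => x r * pd r f x - j r * f x

/-- `D_r⁻ f = 2 j_r x_r f - x_r² ∂f/∂x_r`. -/
noncomputable def Dm {m : ℕ} (j : Fin m → ℂ) (r : Fin m) (f : (Fin m → ℂ) → ℂ) :
    (Fin m → ℂ) → ℂ :=
  fun x => 2 * j r * x r * f x - (x r) ^ 2 * pd r f x

/-- The Gaudin Hamiltonian
`H_r f = ∑_{s≠r} (1/(z_r-z_s)) (D_r⁰ D_s⁰ f + ½ D_r⁺ D_s⁻ f + ½ D_r⁻ D_s⁺ f)`. -/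
noncomputable def Ham {m : ℕ} (z j : Fin m → ℂ) (r : Fin m) (f : (Fin m → ℂ) → ℂ) :
    (Fin m → ℂ) → ℂ :=
  fun x => ∑ s ∈ Finset.univ.erase r, (1 / (z r - z s)) *
    (D0 j r (D0 j s f) x + (1 / 2) * pd r (Dm j s f) x + (1 / 2) * Dm j r (pd s f) x)

open Metric Topology MeasureTheory in
/-- A directional derivative of a holomorphic function of several variables is holomorphic. -/
theorem differentiableOn_fderiv_apply {E : Type*} [NormedAddCommGroup E]
    [NormedSpace ℂ E] [FiniteDimensional ℂ E] {U : Set E} {f : E → ℂ}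
    (hU : IsOpen U) (hf : DifferentiableOn ℂ f U) {v : E} (hv : ‖v‖ ≤ 1) :
    DifferentiableOn ℂ (fun x => fderiv ℂ f x v) U := by
  intro x₀ hx₀
  borelize E
  have hcont : ContinuousAt f x₀ := (hf.differentiableAt (hU.mem_nhds hx₀)).continuousAt
  obtain ⟨ρ, hρ, hball⟩ : ∃ ρ > 0, ball x₀ ρ ⊆ U ∩ f ⁻¹' ball (f x₀) 1 :=
    Metric.mem_nhds_iff.1 (Filter.inter_mem (hU.mem_nhds hx₀)
      (hcont.preimage_mem_nhds (ball_mem_nhds _ one_pos)))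
  obtain ⟨R, hR, rfl⟩ : ∃ R > 0, ρ = 3 * R := ⟨ρ / 3, by positivity, by ring⟩
  have hfd (y) (hy : y ∈ ball x₀ (3 * R)) : DifferentiableAt ℂ f y :=
    hf.differentiableAt (hU.mem_nhds (hball hy).1)
  have hbound (y) (hy : y ∈ ball x₀ (2 * R)) : ‖fderiv ℂ f y‖ ≤ 2 / R := by
    have hsub : ball y R ⊆ ball x₀ (3 * R) :=
      ball_subset_ball' (by rw [mem_ball] at hy; linarith)
    refine Complex.norm_fderiv_le_div_of_mapsTo_ball
      (fun w hw => (hfd w (hsub hw)).differentiableWithinAt) (fun w hw => ?_) hR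
    have h₁ : dist (f w) (f x₀) < 1 := (hball (hsub hw)).2
    have h₂ : dist (f y) (f x₀) < 1 := (hball (hsub (mem_ball_self hR))).2
    have := dist_triangle_right (f w) (f y) (f x₀)
    rw [mem_closedBall]
    linarith
  have hmem (x) (hx : x ∈ ball x₀ R) (ζ : ℂ) (hζ : ‖ζ‖ ≤ R) : x + ζ • v ∈ ball x₀ (2 * R) := by
    rw [mem_ball, dist_eq_norm] at *
    calc ‖x + ζ • v - x₀‖ = ‖(x - x₀) + ζ • v‖ := by congr 1; abel
      _ ≤ ‖x - x₀‖ + ‖ζ‖ * ‖v‖ := (norm_add_le _ _).trans (by rw [norm_smul])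
      _ < 2 * R := by nlinarith [norm_nonneg ζ, norm_nonneg v]
  have hmem' (x) (hx : x ∈ ball x₀ R) (ζ : ℂ) (hζ : ‖ζ‖ ≤ R) : x + ζ • v ∈ ball x₀ (3 * R) :=
    ball_subset_ball (by linarith) (hmem x hx ζ hζ)
  have hcauchy (x) (hx : x ∈ ball x₀ R) : fderiv ℂ f x v =
      (2 * Real.pi * Complex.I : ℂ)⁻¹ • ∮ ζ in C(0, R), (1 / (ζ - 0) ^ 2) • f (x + ζ • v) := by
    have hline (ζ : ℂ) (hζ : ‖ζ‖ ≤ R) :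
        HasDerivAt (fun ζ : ℂ => f (x + ζ • v)) (fderiv ℂ f (x + ζ • v) v) ζ := by
      have h : HasDerivAt (fun ζ : ℂ => x + ζ • v) v ζ := by
        simpa using ((hasDerivAt_id ζ).smul_const v).const_add x
      exact (hfd _ (hmem' x hx ζ hζ)).hasFDerivAt.comp_hasDerivAt ζ h
    have hd : DifferentiableOn ℂ (fun ζ : ℂ => f (x + ζ • v)) (closedBall 0 R) := fun ζ hζ =>
      (hline ζ (by simpa using hζ)).differentiableAt.differentiableWithinAt
    rw [hd.deriv_eq_smul_circleIntegral hR, inv_smul_smul₀ Complex.two_pi_I_ne_zero,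
      (hline 0 (by simpa using hR.le)).deriv]
    simp
  have hnorm (θ : ℝ) : ‖circleMap 0 R θ‖ ≤ R := by simp [abs_of_pos hR]
  set c : ℝ → ℂ := fun θ => deriv (circleMap 0 R) θ * (1 / (circleMap 0 R θ - 0) ^ 2) with hc
  have hc_cont : Continuous c := by
    simp only [hc, deriv_circleMap, sub_zero]
    have h0 (θ : ℝ) : circleMap 0 R θ ^ 2 ≠ 0 := pow_ne_zero _ (circleMap_ne_center hR.ne')
    fun_prop (disch := exact h0 _)
  have hF_cont (x) (hx : x ∈ ball x₀ R) :
      Continuous fun θ => c θ • f (x + circleMap 0 R θ • v) := by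
    refine hc_cont.smul (continuous_iff_continuousAt.2 fun θ => ?_)
    exact ContinuousAt.comp (f := fun θ => x + circleMap 0 R θ • v)
      (hfd _ (hmem' x hx _ (hnorm θ))).continuousAt (by fun_prop)
  have hdiff := intervalIntegral.hasFDerivAt_integral_of_dominated_of_fderiv_le
    (μ := volume) (a := 0) (b := 2 * Real.pi) (𝕜 := ℂ)
    (F := fun x θ => c θ • f (x + circleMap 0 R θ • v))
    (F' := fun x θ => c θ • fderiv ℂ f (x + circleMap 0 R θ • v))
    (bound := fun θ => ‖c θ‖ * (2 / R))
    (ball_mem_nhds x₀ hR)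
    (Filter.eventually_of_mem (ball_mem_nhds x₀ hR)
      fun x hx => (hF_cont x hx).aestronglyMeasurable)
    ((hF_cont x₀ (mem_ball_self hR)).intervalIntegrable _ _)
    (hc_cont.aestronglyMeasurable.smul
      ((measurable_fderiv ℂ f).comp (by fun_prop)).aestronglyMeasurable)
    (.of_forall fun θ _ x hx => by
      rw [norm_smul]
      gcongr
      exact hbound _ (hmem x hx _ (hnorm θ)))
    ((by fun_prop : Continuous fun θ => ‖c θ‖ * (2 / R)).intervalIntegrable _ _)
    (.of_forall fun θ _ x hx => by
      have := (hfd _ (hmem' x hx _ (hnorm θ))).hasFDerivAt.comp x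
        ((hasFDerivAt_id x).add_const (circleMap 0 R θ • v))
      exact this.const_smul (c θ))
  have hev : (fun x => fderiv ℂ f x v) =ᶠ[𝓝 x₀] fun x => (2 * Real.pi * Complex.I : ℂ)⁻¹ •
      ∫ θ in 0..2 * Real.pi, c θ • f (x + circleMap 0 R θ • v) := by
    filter_upwards [ball_mem_nhds x₀ hR] with x hx
    rw [hcauchy x hx]
    simp only [circleIntegral, hc, smul_smul]
  exact ((hdiff.differentiableAt.fun_const_smul _).congr_of_eventuallyEq hev).differentiableWithinAt

/-- Three families in a ring, each triple `(e r, h r, f r)` satisfying the `sl₂` relations in the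
normalization `[h, e] = -e`, `[h, f] = f`, `[e, f] = -2h`, and different triples commuting. -/
structure IsSl2Family {ι A : Type*} [Ring A] (e h f : ι → A) : Prop where
  h_mul_e : ∀ r, h r * e r = e r * h r - e r
  h_mul_f : ∀ r, h r * f r = f r * h r + f r
  f_mul_e : ∀ r, f r * e r = e r * f r + 2 * h r
  commute_ee : ∀ {r s}, r ≠ s → Commute (e r) (e s)
  commute_hh : ∀ {r s}, r ≠ s → Commute (h r) (h s)
  commute_ff : ∀ {r s}, r ≠ s → Commute (f r) (f s)
  commute_eh : ∀ {r s}, r ≠ s → Commute (e r) (h s)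
  commute_ef : ∀ {r s}, r ≠ s → Commute (e r) (f s)
  commute_hf : ∀ {r s}, r ≠ s → Commute (h r) (f s)

/-- Twice the two-site Casimir element. -/
def casimir {ι A : Type*} [Ring A] (e h f : ι → A) (r s : ι) : A :=
  2 * h r * h s + e r * f s + f r * e s

namespace IsSl2Family

section Casimir

variable {ι A : Type*} [Ring A] {e h f : ι → A}

/-- Exchanging `e` and `f` and changing the sign of `h` preserves the relations. -/
theorem swap (H : IsSl2Family e h f) : IsSl2Family f (-h) e where
  h_mul_e r := by simp [H.h_mul_f r]; abel
  h_mul_f r := by simp [H.h_mul_e r]; abel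
  f_mul_e r := by simp [H.f_mul_e r]
  commute_ee := H.commute_ff
  commute_hh hrs := (H.commute_hh hrs).neg_left.neg_right
  commute_ff := H.commute_ee
  commute_eh hrs := (H.commute_hf hrs.symm).symm.neg_right
  commute_ef hrs := (H.commute_ef hrs.symm).symm
  commute_hf hrs := (H.commute_eh hrs.symm).symm.neg_left

theorem casimir_symm (H : IsSl2Family e h f) {r s : ι} (hrs : r ≠ s) :
    casimir e h f r s = casimir e h f s r := by
  simp only [casimir, mul_assoc, (H.commute_hh hrs).eq, (H.commute_ef hrs).eq,
    (H.commute_ef hrs.symm).eq]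
  abel

theorem commute_casimir_h (H : IsSl2Family e h f) {r s : ι} (hrs : r ≠ s) :
    Commute (casimir e h f r s) (h r + h s) := by
  rw [casimir, Commute, SemiconjBy]
  linear_combination (norm := noncomm_ring)
    -2 * h r * (H.commute_hh hrs).eq + 2 * (H.commute_hh hrs).eq * h s
    - e r * (H.commute_hf hrs).eq - H.h_mul_e r * f s - e r * H.h_mul_f s
    + (H.commute_eh hrs).eq * f s + f r * (H.commute_eh hrs.symm).eq - H.h_mul_f r * e s
    - f r * H.h_mul_e s - (H.commute_hf hrs.symm).eq * e s

theorem commute_casimir_e (H : IsSl2Family e h f) {r s : ι} (hrs : r ≠ s) :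
    Commute (casimir e h f r s) (e r + e s) := by
  rw [casimir, Commute, SemiconjBy]
  linear_combination (norm := noncomm_ring)
    -2 * h r * (H.commute_eh hrs).eq + 2 * H.h_mul_e r * h s + 2 * h r * H.h_mul_e s
    - 2 * (H.commute_eh hrs.symm).eq * h s - e r * (H.commute_ef hrs).eq + e r * H.f_mul_e s
    + (H.commute_ee hrs).eq * f s - f r * (H.commute_ee hrs).eq + H.f_mul_e r * e s
    - (H.commute_ef hrs.symm).eq * e s

theorem commute_casimir_f (H : IsSl2Family e h f) {r s : ι} (hrs : r ≠ s) :
    Commute (casimir e h f r s) (f r + f s) := by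
  convert H.swap.commute_casimir_e hrs using 1
  simp only [casimir, Pi.neg_apply]
  noncomm_ring

/-- An element commuting with both sites commutes with the Casimir element. -/
theorem commute_casimir {r s : ι} {a : A} (hr : Commute a (e r) ∧ Commute a (h r) ∧ Commute a (f r))
    (hs : Commute a (e s) ∧ Commute a (h s) ∧ Commute a (f s)) :
    Commute a (casimir e h f r s) :=
  ((((Commute.ofNat_right a 2).mul_right hr.2.1).mul_right hs.2.1).add_right
    (hr.1.mul_right hs.2.2)).add_right (hr.2.2.mul_right hs.1)

theorem commute_casimir_of_ne (H : IsSl2Family e h f) {r s t : ι} (hr : t ≠ r) (hs : t ≠ s) :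
    Commute (e t) (casimir e h f r s) ∧ Commute (h t) (casimir e h f r s) ∧
      Commute (f t) (casimir e h f r s) :=
  ⟨commute_casimir ⟨H.commute_ee hr, H.commute_eh hr, H.commute_ef hr⟩
      ⟨H.commute_ee hs, H.commute_eh hs, H.commute_ef hs⟩,
    commute_casimir ⟨(H.commute_eh hr.symm).symm, H.commute_hh hr, H.commute_hf hr⟩
      ⟨(H.commute_eh hs.symm).symm, H.commute_hh hs, H.commute_hf hs⟩,
    commute_casimir ⟨(H.commute_ef hr.symm).symm, (H.commute_hf hr.symm).symm, H.commute_ff hr⟩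
      ⟨(H.commute_ef hs.symm).symm, (H.commute_hf hs.symm).symm, H.commute_ff hs⟩⟩

theorem commute_casimir_casimir (H : IsSl2Family e h f) {r s t u : ι} (hrt : r ≠ t) (hru : r ≠ u)
    (hst : s ≠ t) (hsu : s ≠ u) : Commute (casimir e h f r s) (casimir e h f t u) := by
  have ht := H.commute_casimir_of_ne hrt.symm hst.symm
  have hu := H.commute_casimir_of_ne hru.symm hsu.symm
  exact commute_casimir ⟨ht.1.symm, ht.2.1.symm, ht.2.2.symm⟩ ⟨hu.1.symm, hu.2.1.symm, hu.2.2.symm⟩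

/-- The infinitesimal braid relation. -/
theorem commute_casimir_add (H : IsSl2Family e h f) {r s t : ι} (hrs : r ≠ s) (hrt : r ≠ t)
    (hst : s ≠ t) :
    Commute (casimir e h f r s) (casimir e h f r t + casimir e h f s t) := by
  have ht := H.commute_casimir_of_ne hrt.symm hst.symm
  have hsum : casimir e h f r t + casimir e h f s t =
      2 * (h r + h s) * h t + (e r + e s) * f t + (f r + f s) * e t := by
    simp only [casimir]
    noncomm_ring
  rw [hsum]
  exact ((((Commute.ofNat_right _ 2).mul_right (H.commute_casimir_h hrs)).mul_right
    ht.2.1.symm).add_right ((H.commute_casimir_e hrs).mul_right ht.2.2.symm)).add_right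
    ((H.commute_casimir_f hrs).mul_right ht.1.symm)

end Casimir

/-- Commutativity of the abstract Gaudin Hamiltonians. -/
theorem commute_gaudin {ι A K : Type*} [Fintype ι] [DecidableEq ι] [Ring A] [Field K] [Algebra K A]
    {e h f : ι → A} (H : IsSl2Family e h f) {z : ι → K} (hz : Function.Injective z) (r s : ι) :
    Commute (∑ a ∈ Finset.univ.erase r, (1 / (z r - z a)) • casimir e h f r a)
      (∑ b ∈ Finset.univ.erase s, (1 / (z s - z b)) • casimir e h f s b) := by
  let _ : LieRing A := LieRing.ofAssociativeRing
  obtain rfl | hrs := eq_or_ne r s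
  · exact Commute.refl _
  set T : Finset ι := (Finset.univ.erase r).erase s with hT
  have hT' : (Finset.univ.erase s).erase r = T := Finset.erase_right_comm
  rw [← Finset.add_sum_erase _ _ (Finset.mem_erase.2 ⟨hrs.symm, Finset.mem_univ s⟩), ← hT,
    ← Finset.add_sum_erase _ _ (Finset.mem_erase.2 ⟨hrs, Finset.mem_univ r⟩), hT',
    H.casimir_symm hrs.symm, commute_iff_lie_eq]
  have hdiag : ∑ a ∈ T, ∑ b ∈ T, ⁅(1 / (z r - z a)) • casimir e h f r a,
      (1 / (z s - z b)) • casimir e h f s b⁆ =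
      ∑ a ∈ T, ⁅(1 / (z r - z a)) • casimir e h f r a,
        (1 / (z s - z a)) • casimir e h f s a⁆ := by
    refine Finset.sum_congr rfl fun a ha => Finset.sum_eq_single_of_mem a ha fun b hb hba => ?_
    simp only [hT, Finset.mem_erase] at ha hb
    rw [← commute_iff_lie_eq]
    exact ((H.commute_casimir_casimir hrs (Ne.symm hb.2.1) ha.1 hba.symm).smul_left _).smul_right _
  rw [add_lie, lie_add, lie_add, sum_lie_sum, hdiag, lie_sum, sum_lie,
    commute_iff_lie_eq.1 (((Commute.refl _).smul_left _).smul_right _), zero_add,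
    ← Finset.sum_add_distrib, ← Finset.sum_add_distrib]
  refine Finset.sum_eq_zero fun a ha => ?_
  simp only [hT, Finset.mem_erase, Finset.mem_univ, and_true] at ha
  have h₁ : ⁅casimir e h f r a, casimir e h f r s⁆ = ⁅casimir e h f r s, casimir e h f s a⁆ := by
    have := (H.commute_casimir_add hrs ha.2.symm ha.1.symm).lie_eq
    rw [lie_add] at this
    rw [← lie_skew, eq_neg_of_add_eq_zero_left this, neg_neg]
  have h₂ : ⁅casimir e h f r a, casimir e h f s a⁆ = -⁅casimir e h f r s, casimir e h f s a⁆ := by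
    have := (H.commute_casimir_add ha.2.symm hrs ha.1).lie_eq
    rw [lie_add, H.casimir_symm ha.1] at this
    rw [eq_neg_of_add_eq_zero_right this, h₁]
  have hsmul (c d : K) (a b : A) : ⁅c • a, d • b⁆ = (c * d) • ⁅a, b⁆ := by
    simp only [Ring.lie_def, smul_sub, smul_mul_smul_comm, mul_comm d c]
  simp only [hsmul, h₁, h₂, smul_neg, ← neg_smul, ← add_smul]
  refine smul_eq_zero_of_left ?_ _
  have hrs' : z r - z s ≠ 0 := sub_ne_zero.2 (hz.ne hrs)
  have hsr' : z s - z r ≠ 0 := sub_ne_zero.2 (hz.ne hrs.symm)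
  have hra' : z r - z a ≠ 0 := sub_ne_zero.2 (hz.ne ha.2.symm)
  have hsa' : z s - z a ≠ 0 := sub_ne_zero.2 (hz.ne ha.1.symm)
  rw [← neg_sub (z r) (z s)]
  field_simp
  ring

end IsSl2Family

/-- Elements `X r`, `P r` satisfying the canonical commutation relations `[P r, X s] = δ_{rs}`,
together with central elements `c r`, yield commuting copies of `sl₂`. -/
theorem isSl2Family_of_canonical_commutation {ι A : Type*} [Ring A] {X P c : ι → A}
    (hPX : ∀ r, P r * X r = X r * P r + 1)
    (hPX' : ∀ {r s}, r ≠ s → Commute (P r) (X s))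
    (hPP : ∀ r s, Commute (P r) (P s)) (hXX : ∀ r s, Commute (X r) (X s))
    (hc : ∀ r a, Commute (c r) a) :
    IsSl2Family P (fun r => X r * P r - c r) (fun r => 2 * c r * X r - X r * X r * P r) := by
  have hc' (r a) : Commute a (c r) := (hc r a).symm
  have hXP {r s} (hrs : r ≠ s) : Commute (X r) (P s) := (hPX' hrs.symm).symm
  have hX_f {r s} (hrs : r ≠ s) : Commute (X r) (2 * c s * X s - X s * X s * P s) := by
    apply_rules [Commute.sub_right, Commute.mul_right, Commute.ofNat_right]
  have hP_f {r s} (hrs : r ≠ s) : Commute (P r) (2 * c s * X s - X s * X s * P s) := by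
    apply_rules [Commute.sub_right, Commute.mul_right, Commute.ofNat_right]
  have hP_h {r s} (hrs : r ≠ s) : Commute (P r) (X s * P s - c s) := by
    apply_rules [Commute.sub_right, Commute.mul_right]
  have hX_h {r s} (hrs : r ≠ s) : Commute (X r) (X s * P s - c s) := by
    apply_rules [Commute.sub_right, Commute.mul_right]
  exact {
    h_mul_e := fun r => by
      linear_combination (norm := noncomm_ring) -hPX r * P r - (hc r (P r)).eq
    h_mul_f := fun r => by
      linear_combination (norm := noncomm_ring) 2 * X r * (hc' r (P r)).eq * X r
        + 2 * (hc' r (X r)).eq * P r * X r + 2 * c r * X r * hPX r - X r * hPX r * X r * P r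
        + 2 * c r * (hc' r (X r)).eq - (hc' r (X r * X r * P r)).eq
    f_mul_e := fun r => by
      linear_combination (norm := noncomm_ring) -2 * (hc' r (P r)).eq * X r - 2 * c r * hPX r
        + hPX r * X r * P r + X r * hPX r * P r
    commute_ee := fun _ => hPP _ _
    commute_hh := fun hrs => ((hX_h hrs).mul_left (hP_h hrs)).sub_left (hc _ _)
    commute_ff := fun hrs => ((((Commute.ofNat_left 2 _).mul_left (hc _ _)).mul_left
      (hX_f hrs))).sub_left (((hX_f hrs).mul_left (hX_f hrs)).mul_left (hP_f hrs))
    commute_eh := hP_h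
    commute_ef := hP_f
    commute_hf := fun hrs => ((hX_f hrs).mul_left (hP_f hrs)).sub_left (hc _ _) }

section Operators

variable {m : ℕ} {U : Set (Fin m → ℂ)}

theorem differentiableOn_pd (hU : IsOpen U) {f : (Fin m → ℂ) → ℂ} (hf : DifferentiableOn ℂ f U)
    (r : Fin m) : DifferentiableOn ℂ (pd r f) U :=
  differentiableOn_fderiv_apply hU hf (by simp [Pi.norm_single])

/-- Mixed partial derivatives of holomorphic functions commute. -/
theorem pd_comm (hU : IsOpen U) {f : (Fin m → ℂ) → ℂ} (hf : DifferentiableOn ℂ f U)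
    (r s : Fin m) {x : Fin m → ℂ} (hx : x ∈ U) : pd r (pd s f) x = pd s (pd r f) x := by
  have hfd : DifferentiableAt ℂ (fderiv ℂ f) x := by
    have hsum (y : Fin m → ℂ) : fderiv ℂ f y =
        ∑ i, pd i f y • (ContinuousLinearMap.proj i : (Fin m → ℂ) →L[ℂ] ℂ) := by
      ext v
      conv_lhs => rw [pi_eq_sum_univ' v]
      simp [pd, map_sum, mul_comm]
    rw [funext hsum]
    exact .fun_sum fun i _ =>
      ((differentiableOn_pd hU hf i).differentiableAt (hU.mem_nhds hx)).smul_const _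
  have hsymm := second_derivative_symmetric_of_eventually
    (Filter.eventually_of_mem (hU.mem_nhds hx)
      fun y hy => (hf.differentiableAt (hU.mem_nhds hy)).hasFDerivAt)
    hfd.hasFDerivAt (Pi.single r 1) (Pi.single s 1)
  have hpd (i k : Fin m) : pd i (pd k f) x =
      fderiv ℂ (fderiv ℂ f) x (Pi.single i 1) (Pi.single k 1) := by
    have := (hfd.hasFDerivAt.clm_apply
      (hasFDerivAt_const (Pi.single k (1 : ℂ) : Fin m → ℂ) x)).fderiv
    change fderiv ℂ (fun y => fderiv ℂ f y (Pi.single k 1)) x (Pi.single i 1) = _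
    rw [this]
    simp
  rw [hpd, hpd, hsymm]

theorem pd_congr (hU : IsOpen U) {f g : (Fin m → ℂ) → ℂ} (h : Set.EqOn f g U) (r : Fin m) :
    Set.EqOn (pd r f) (pd r g) U := fun _ hx => by
  rw [pd, pd, (h.eventuallyEq_of_mem (hU.mem_nhds hx)).fderiv_eq]

/-- Holomorphic functions on `U`, extended by zero. -/
def holomorphicOn (U : Set (Fin m → ℂ)) : Submodule ℂ ((Fin m → ℂ) → ℂ) where
  carrier := {f | DifferentiableOn ℂ f U ∧ ∀ x ∉ U, f x = 0}
  add_mem' hf hg := ⟨hf.1.add hg.1, fun x hx => by simp [hf.2 x hx, hg.2 x hx]⟩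
  zero_mem' := ⟨differentiableOn_const 0, fun _ _ => rfl⟩
  smul_mem' c _ hf := ⟨hf.1.const_smul c, fun x hx => by simp [hf.2 x hx]⟩

theorem indicator_mem_holomorphicOn {f : (Fin m → ℂ) → ℂ} (hf : DifferentiableOn ℂ f U) :
    U.indicator f ∈ holomorphicOn U :=
  ⟨hf.congr fun _ hx => Set.indicator_of_mem hx f, fun _ hx => Set.indicator_of_notMem hx f⟩

theorem holomorphicOn_ext {F G : holomorphicOn U} (h : Set.EqOn F.1 G.1 U) : F = G := by
  ext x
  by_cases hx : x ∈ U
  · exact h hx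
  · rw [F.2.2 x hx, G.2.2 x hx]

/-- Partial differentiation as an operator on holomorphic functions. -/
noncomputable def pdOp (hU : IsOpen U) (r : Fin m) : Module.End ℂ (holomorphicOn U) where
  toFun F := ⟨U.indicator (pd r F.1), indicator_mem_holomorphicOn (differentiableOn_pd hU F.2.1 r)⟩
  map_add' F G := holomorphicOn_ext fun x hx => by
    have hF := F.2.1.differentiableAt (hU.mem_nhds hx)
    have hG := G.2.1.differentiableAt (hU.mem_nhds hx)
    simp [Set.indicator_of_mem hx, pd, fderiv_add hF hG]
  map_smul' c F := holomorphicOn_ext fun x hx => by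
    have hF := F.2.1.differentiableAt (hU.mem_nhds hx)
    simp [Set.indicator_of_mem hx, pd, fderiv_const_smul hF]

/-- Multiplication by a coordinate as an operator on holomorphic functions. -/
noncomputable def coordOp (U : Set (Fin m → ℂ)) (r : Fin m) : Module.End ℂ (holomorphicOn U) where
  toFun F := ⟨fun x => x r * F.1 x, (differentiable_apply r).differentiableOn.mul F.2.1,
    fun x hx => by simp [F.2.2 x hx]⟩
  map_add' F G := by ext x; simp [mul_add]
  map_smul' c F := by ext x; simp [mul_left_comm]

theorem coordOp_apply (r : Fin m) (F : holomorphicOn U) (x : Fin m → ℂ) :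
    (coordOp U r F).1 x = x r * F.1 x := rfl

theorem pdOp_apply (hU : IsOpen U) (r : Fin m) (F : holomorphicOn U) :
    Set.EqOn (pdOp hU r F).1 (pd r F.1) U := fun _ hx => Set.indicator_of_mem hx _

theorem pdOp_mul_coordOp (hU : IsOpen U) (r s : Fin m) (F : holomorphicOn U) {x : Fin m → ℂ}
    (hx : x ∈ U) : ((pdOp hU r * coordOp U s) F).1 x =
      x s * pd r F.1 x + (Pi.single r 1 : Fin m → ℂ) s * F.1 x := by
  have hF := (F.2.1.differentiableAt (hU.mem_nhds hx)).hasFDerivAt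
  have hs : HasFDerivAt (fun y : Fin m → ℂ => y s) (ContinuousLinearMap.proj (R := ℂ) s) x :=
    hasFDerivAt_apply (𝕜 := ℂ) s x
  rw [Module.End.mul_apply, pdOp_apply hU r _ hx]
  change fderiv ℂ (fun y => y s * F.1 y) x (Pi.single r 1) = _
  rw [(hs.fun_mul hF).fderiv]
  simp [pd, mul_comm]

theorem isSl2Family_holomorphicOn (hU : IsOpen U) (j : Fin m → ℂ) :
    IsSl2Family (pdOp hU)
      (fun r => coordOp U r * pdOp hU r - algebraMap ℂ (Module.End ℂ (holomorphicOn U)) (j r))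
      (fun r => 2 * algebraMap ℂ (Module.End ℂ (holomorphicOn U)) (j r) * coordOp U r
        - coordOp U r * coordOp U r * pdOp hU r) := by
  refine isSl2Family_of_canonical_commutation (c := fun r => algebraMap ℂ _ (j r))
    (fun r => ?_) (fun {r s} hrs => ?_) (fun r s => ?_) (fun r s => ?_)
    (fun r a => Algebra.commutes _ _)
  · refine LinearMap.ext fun F => holomorphicOn_ext fun x hx => ?_
    rw [pdOp_mul_coordOp hU r r F hx]
    simp [coordOp_apply, pdOp_apply hU r F hx]
  · refine LinearMap.ext fun F => holomorphicOn_ext fun x hx => ?_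
    rw [pdOp_mul_coordOp hU r s F hx]
    simp [coordOp_apply, pdOp_apply hU r F hx, hrs.symm]
  · refine LinearMap.ext fun F => holomorphicOn_ext fun x hx => ?_
    simp only [Module.End.mul_apply]
    rw [pdOp_apply hU r _ hx, pdOp_apply hU s _ hx, pd_congr hU (pdOp_apply hU s F) r hx,
      pd_congr hU (pdOp_apply hU r F) s hx, pd_comm hU F.2.1 r s hx]
  · refine LinearMap.ext fun F => holomorphicOn_ext fun x _ => ?_
    simp [coordOp_apply, mul_left_comm]

variable {f : (Fin m → ℂ) → ℂ} {F : holomorphicOn U}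

theorem pd_eqOn_pdOp (hU : IsOpen U) (h : Set.EqOn f F.1 U) (r : Fin m) :
    Set.EqOn (pd r f) (pdOp hU r F).1 U :=
  (pd_congr hU h r).trans (pdOp_apply hU r F).symm

theorem D0_eqOn (hU : IsOpen U) (h : Set.EqOn f F.1 U) (j : Fin m → ℂ) (r : Fin m) :
    Set.EqOn (D0 j r f) ((coordOp U r * pdOp hU r - algebraMap ℂ _ (j r)) F).1 U := fun x hx => by
  simp [D0, pd_eqOn_pdOp hU h r hx, h hx, coordOp_apply]

theorem Dm_eqOn (hU : IsOpen U) (h : Set.EqOn f F.1 U) (j : Fin m → ℂ) (r : Fin m) :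
    Set.EqOn (Dm j r f) ((2 * algebraMap ℂ _ (j r) * coordOp U r
      - coordOp U r * coordOp U r * pdOp hU r) F).1 U := fun x hx => by
  simp [Dm, pd_eqOn_pdOp hU h r hx, h hx, coordOp_apply]
  ring

/-- The Gaudin Hamiltonian as an operator on holomorphic functions. -/
noncomputable def gaudinOp (hU : IsOpen U) (z j : Fin m → ℂ) (r : Fin m) :
    Module.End ℂ (holomorphicOn U) :=
  ∑ s ∈ Finset.univ.erase r, (1 / (z r - z s)) • casimir (pdOp hU)
    (fun r => coordOp U r * pdOp hU r - algebraMap ℂ _ (j r))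
    (fun r => 2 * algebraMap ℂ _ (j r) * coordOp U r - coordOp U r * coordOp U r * pdOp hU r) r s

theorem Ham_eqOn (hU : IsOpen U) (h : Set.EqOn f F.1 U) (z j : Fin m → ℂ) (r : Fin m) :
    Set.EqOn (Ham z j r f) (((1 / 2 : ℂ) • gaudinOp hU z j r) F).1 U := fun x hx => by
  have hsum : (((1 / 2 : ℂ) • gaudinOp hU z j r) F).1 x = ∑ s ∈ Finset.univ.erase r,
      (1 / 2 : ℂ) * ((1 / (z r - z s)) * (casimir (pdOp hU)
        (fun r => coordOp U r * pdOp hU r - algebraMap ℂ _ (j r))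
        (fun r => 2 * algebraMap ℂ _ (j r) * coordOp U r
          - coordOp U r * coordOp U r * pdOp hU r) r s F).1 x) := by
    simp [gaudinOp, LinearMap.sum_apply, Finset.mul_sum]
  rw [hsum, Ham]
  refine Finset.sum_congr rfl fun s _ => ?_
  rw [D0_eqOn hU (D0_eqOn hU h j s) j r hx, pd_eqOn_pdOp hU (Dm_eqOn hU h j s) r hx,
    Dm_eqOn hU (pd_eqOn_pdOp hU h s) j r hx, casimir, mul_assoc (2 : Module.End ℂ _)]
  simp only [LinearMap.add_apply, Module.End.mul_apply, two_mul, Submodule.coe_add,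
    Pi.add_apply]
  ring

end Operators

/-- The Gaudin Hamiltonians commute on holomorphic functions:
`H_r (H_s f) = H_s (H_r f)`. -/
theorem statement19 (m : ℕ) (hm : 2 ≤ m) (z : Fin m → ℂ) (hz : Function.Injective z)
    (j : Fin m → ℂ) (U : Set (Fin m → ℂ)) (hU : IsOpen U)
    (f : (Fin m → ℂ) → ℂ) (hf : DifferentiableOn ℂ f U)
    (r s : Fin m) (x : Fin m → ℂ) (hx : x ∈ U) :
    Ham z j r (Ham z j s f) x = Ham z j s (Ham z j r f) x := by
  have hF : Set.EqOn f (⟨_, indicator_mem_holomorphicOn hf⟩ : holomorphicOn U).1 U :=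
    fun y hy => (Set.indicator_of_mem hy f).symm
  have hcomm : Commute ((1 / 2 : ℂ) • gaudinOp hU z j r) ((1 / 2 : ℂ) • gaudinOp hU z j s) :=
    (((isSl2Family_holomorphicOn hU j).commute_gaudin hz r s).smul_left _).smul_right _
  rw [Ham_eqOn hU (Ham_eqOn hU hF z j s) z j r hx, Ham_eqOn hU (Ham_eqOn hU hF z j r) z j s hx,
    ← Module.End.mul_apply, hcomm.eq, Module.End.mul_apply]
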